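/- Let {η1^{(i)}}_{i=0}^{q1} ⊂ [−1,1], {η2^{(i)}}_{i=0}^{q2} ⊂ [−1,1), {η3^{(i)}}_{i=0}^{q3} ⊂ [−1,1) be quadrature nodes with positive weights whose one-dimensional rules are exact of degrees τ1 ≥ 2q1, τ2 ≥ 2q2+1, and τ3 ≥ 2q3+1, respectively, with Lagrange bases ℓ1^{(i)}, ℓ2^{(i)}, ℓ3^{(i)}. Let W be the diagonal matrix with entries W_{α,α} = ((1−η2^{(α2)})(1−η3^{(α3)})²/8) ω1^{(α1)} ω2^{(α2)} ω3^{(α3)} and let Q^{(3)} = W D^{(3)}, where D^{(3)} is the collapsed-coordinate differentiation matrix in the ξ3 direction on the reference tetrahedron. Then for all multi-indices α, β, Q^{(3)}_{α,β} + Q^{(3)}_{β,α} = ℓ1^{(α1)}(1) ℓ1^{(β1)}(1) ∫_{−1}^{1} ℓ2^{(α2)}(s) ℓ2^{(β2)}(s) ds ∫_{−1}^{1} ((1−s)/2) ℓ3^{(α3)}(s) ℓ3^{(β3)}(s) ds − ℓ3^{(α3)}(−1) ℓ3^{(β3)}(−1) ∫_{−1}^{1} ℓ1^{(α1)}(s)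 ℓ1^{(β1)}(s) ds ∫_{−1}^{1} ((1−s)/2) ℓ2^{(α2)}(s) ℓ2^{(β2)}(s) ds. -/

import Mathlib

noncomputable section

/-- The collapsed coordinate map from the cube onto the reference tetrahedron. -/
def chi3 (η : ℝ × ℝ × ℝ) : ℝ × ℝ × ℝ :=
  ((1 + η.1) * (1 - η.2.1) * (1 - η.2.2) / 4 - 1,
   (1 + η.2.1) * (1 - η.2.2) / 2 - 1, η.2.2)

/-- Lagrange basis function on the nodes `η`. -/
def lagr {n : ℕ} (η : Fin n → ℝ) (i : Fin n) (x : ℝ) : ℝ :=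
  ∏ j ∈ Finset.univ.erase i, (x - η j) / (η i - η j)

/-- Evaluation of a trivariate polynomial at a point of `ℝ × ℝ × ℝ`. -/
def ev3 (v : MvPolynomial (Fin 3) ℝ) (x : ℝ × ℝ × ℝ) : ℝ :=
  MvPolynomial.eval ![x.1, x.2.1, x.2.2] v

/-- The reference tetrahedron `T̂ = {ξ ∈ [−1,1]³ : ξ1 + ξ2 + ξ3 ≤ −1}`. -/
def refTet : Set (ℝ × ℝ × ℝ) :=
  {ξ | ξ.1 ∈ Set.Icc (-1:ℝ) 1 ∧ ξ.2.1 ∈ Set.Icc (-1:ℝ) 1 ∧ ξ.2.2 ∈ Set.Icc (-1:ℝ) 1 ∧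
    ξ.1 + ξ.2.1 + ξ.2.2 ≤ -1}

/-- A one-dimensional quadrature rule with nodes `η` and weights `ω` is exact of degree `τ`. -/
def exact1D {n : ℕ} (η ω : Fin n → ℝ) (τ : ℕ) : Prop :=
  ∀ f : Polynomial ℝ, f.natDegree ≤ τ →
    ∑ i, ω i * f.eval (η i) = ∫ x in (-1:ℝ)..1, f.eval x

open Polynomial in
theorem lagr_eq_eval_basis {n : ℕ} (η : Fin n → ℝ) (i : Fin n) :
    lagr η i = fun x => (Lagrange.basis Finset.univ η i).eval x := by
  funext x
  simp only [lagr, Lagrange.basis, Lagrange.basisDivisor, eval_prod, eval_mul, eval_C, eval_sub,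
    eval_X]
  exact Finset.prod_congr rfl fun j _ => by rw [div_eq_inv_mul]

theorem eval_lagrange_basis_node {n : ℕ} {η : Fin n → ℝ} (hinj : Function.Injective η)
    (i j : Fin n) :
    (Lagrange.basis Finset.univ η i).eval (η j) = if i = j then 1 else 0 := by
  split_ifs with h
  · subst h
    exact Lagrange.eval_basis_self hinj.injOn (Finset.mem_univ _)
  · exact Lagrange.eval_basis_of_ne h (Finset.mem_univ _)

theorem natDegree_lagrange_basis {q : ℕ} {η : Fin (q + 1) → ℝ} (hinj : Function.Injective η)
    (i : Fin (q + 1)) : (Lagrange.basis Finset.univ η i).natDegree = q := by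
  refine Polynomial.natDegree_eq_of_degree_eq_some ?_
  rw [Lagrange.degree_basis hinj.injOn (Finset.mem_univ _)]
  simp

/-- A sufficiently exact rule gives a diagonal weighted mass matrix in the Lagrange basis. -/
theorem integral_mul_lagr_mul_lagr {q τ : ℕ} {η ω : Fin (q + 1) → ℝ}
    (hinj : Function.Injective η) (he : exact1D η ω τ) (u : Polynomial ℝ)
    (hu : u.natDegree + 2 * q ≤ τ) (a b : Fin (q + 1)) :
    ∫ s in (-1 : ℝ)..1, u.eval s * (lagr η a s * lagr η b s) =
      u.eval (η a) * ω a * if a = b then 1 else 0 := by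
  have h := he (u * (Lagrange.basis Finset.univ η a * Lagrange.basis Finset.univ η b)) <| by
    refine Polynomial.natDegree_mul_le.trans ?_
    have := Polynomial.natDegree_mul_le (p := Lagrange.basis Finset.univ η a)
      (q := Lagrange.basis Finset.univ η b)
    rw [natDegree_lagrange_basis hinj, natDegree_lagrange_basis hinj] at this
    omega
  simp only [Polynomial.eval_mul, eval_lagrange_basis_node hinj] at h
  simp only [lagr_eq_eval_basis, ← h]
  by_cases hab : a = b
  · subst hab
    simp [mul_comm]
  · simp [hab]

/-- Weighted one-dimensional summation by parts in the Lagrange basis. -/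
theorem weighted_summation_by_parts {q τ : ℕ} {η ω : Fin (q + 1) → ℝ}
    (hinj : Function.Injective η) (he : exact1D η ω τ) (w : Polynomial ℝ)
    (hw : w.natDegree + 2 * q ≤ τ + 1) (a b : Fin (q + 1)) :
    w.eval (η a) * ω a * deriv (lagr η b) (η a) + w.eval (η b) * ω b * deriv (lagr η a) (η b) =
      w.eval 1 * (lagr η a 1 * lagr η b 1) - w.eval (-1) * (lagr η a (-1) * lagr η b (-1)) -
        w.derivative.eval (η a) * ω a * if a = b then 1 else 0 := by
  have h := he (w * (Lagrange.basis Finset.univ η a * Lagrange.basis Finset.univ η b)).derivative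
    <| by
    refine (Polynomial.natDegree_derivative_le _).trans ?_
    have h₁ := Polynomial.natDegree_mul_le (p := Lagrange.basis Finset.univ η a)
      (q := Lagrange.basis Finset.univ η b)
    have h₂ := Polynomial.natDegree_mul_le (p := w)
      (q := Lagrange.basis Finset.univ η a * Lagrange.basis Finset.univ η b)
    rw [natDegree_lagrange_basis hinj, natDegree_lagrange_basis hinj] at h₁
    omega
  rw [intervalIntegral.integral_eq_sub_of_hasDerivAt
    (fun x _ => Polynomial.hasDerivAt _ x)
    ((Polynomial.continuous _).intervalIntegrable _ _)] at h
  simp only [Polynomial.derivative_mul, Polynomial.eval_add, Polynomial.eval_mul,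
    eval_lagrange_basis_node hinj, mul_add, Finset.sum_add_distrib, ite_mul, one_mul, zero_mul,
    mul_ite, mul_zero, mul_one, Finset.sum_ite_eq, Finset.mem_univ, if_true] at h
  simp only [lagr_eq_eval_basis, Polynomial.deriv, mul_ite, mul_one, mul_zero]
  rw [← h]
  by_cases hab : a = b
  · subst hab
    simp
    ring
  · simp [hab]
    ring

theorem sbp_property_xi3_tetrahedron (q1 q2 q3 τ1 τ2 τ3 : ℕ)
    (η1 ω1 : Fin (q1 + 1) → ℝ) (η2 ω2 : Fin (q2 + 1) → ℝ) (η3 ω3 : Fin (q3 + 1) → ℝ)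
    (hinj1 : Function.Injective η1) (hinj2 : Function.Injective η2)
    (hinj3 : Function.Injective η3)
    (hr1 : ∀ i, η1 i ∈ Set.Icc (-1:ℝ) 1) (hr2 : ∀ i, η2 i ∈ Set.Ico (-1:ℝ) 1)
    (hr3 : ∀ i, η3 i ∈ Set.Ico (-1:ℝ) 1)
    (hw1 : ∀ i, 0 < ω1 i) (hw2 : ∀ i, 0 < ω2 i) (hw3 : ∀ i, 0 < ω3 i)
    (hτ1 : 2 * q1 ≤ τ1) (hτ2 : 2 * q2 + 1 ≤ τ2) (hτ3 : 2 * q3 + 1 ≤ τ3)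
    (he1 : exact1D η1 ω1 τ1) (he2 : exact1D η2 ω2 τ2) (he3 : exact1D η3 ω3 τ3)
    (Q : (Fin (q1 + 1) × Fin (q2 + 1) × Fin (q3 + 1)) →
         (Fin (q1 + 1) × Fin (q2 + 1) × Fin (q3 + 1)) → ℝ)
    (hQ : ∀ a b, Q a b =
      ((1 - η2 a.2.1) * (1 - η3 a.2.2) ^ 2 / 8 * ω1 a.1 * ω2 a.2.1 * ω3 a.2.2) *
        ((2 * (1 + η1 a.1) / ((1 - η2 a.2.1) * (1 - η3 a.2.2))) *
            deriv (lagr η1 b.1) (η1 a.1) *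
            (if a.2.1 = b.2.1 then (1:ℝ) else 0) * (if a.2.2 = b.2.2 then (1:ℝ) else 0)
          + ((1 + η2 a.2.1) / (1 - η3 a.2.2)) * (if a.1 = b.1 then (1:ℝ) else 0) *
            deriv (lagr η2 b.2.1) (η2 a.2.1) * (if a.2.2 = b.2.2 then (1:ℝ) else 0)
          + (if a.1 = b.1 then (1:ℝ) else 0) * (if a.2.1 = b.2.1 then (1:ℝ) else 0) *
            deriv (lagr η3 b.2.2) (η3 a.2.2))) :
    ∀ a b, Q a b + Q b a =
      lagr η1 a.1 1 * lagr η1 b.1 1 *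
          (∫ s in (-1:ℝ)..1, lagr η2 a.2.1 s * lagr η2 b.2.1 s) *
          (∫ s in (-1:ℝ)..1, ((1 - s) / 2) * (lagr η3 a.2.2 s * lagr η3 b.2.2 s))
        - lagr η3 a.2.2 (-1) * lagr η3 b.2.2 (-1) *
          (∫ s in (-1:ℝ)..1, lagr η1 a.1 s * lagr η1 b.1 s) *
          (∫ s in (-1:ℝ)..1, ((1 - s) / 2) * (lagr η2 a.2.1 s * lagr η2 b.2.1 s)) := by
  rintro ⟨a₁, a₂, a₃⟩ ⟨b₁, b₂, b₃⟩
  have mass₁ := integral_mul_lagr_mul_lagr hinj1 he1 1 (by simpa using hτ1) a₁ b₁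
  have mass₂ := integral_mul_lagr_mul_lagr hinj2 he2 1 (by simp; omega) a₂ b₂
  have deg_half : (Polynomial.C (1 / 2 : ℝ) * (1 - Polynomial.X)).natDegree ≤ 1 := by
    compute_degree
  have half_mass₂ := integral_mul_lagr_mul_lagr hinj2 he2
    (Polynomial.C (1 / 2 : ℝ) * (1 - Polynomial.X)) (by omega) a₂ b₂
  have half_mass₃ := integral_mul_lagr_mul_lagr hinj3 he3
    (Polynomial.C (1 / 2 : ℝ) * (1 - Polynomial.X)) (by omega) a₃ b₃
  have deg₁ : (1 + Polynomial.X : Polynomial ℝ).natDegree ≤ 1 := by compute_degree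
  have deg₂ : (1 - Polynomial.X ^ 2 : Polynomial ℝ).natDegree ≤ 2 := by compute_degree
  have deg₃ : ((1 - Polynomial.X) ^ 2 : Polynomial ℝ).natDegree ≤ 2 := by compute_degree
  have parts₁ := weighted_summation_by_parts hinj1 he1 (1 + Polynomial.X) (by omega) a₁ b₁
  have parts₂ := weighted_summation_by_parts hinj2 he2 (1 - Polynomial.X ^ 2) (by omega) a₂ b₂
  have parts₃ := weighted_summation_by_parts hinj3 he3 ((1 - Polynomial.X) ^ 2) (by omega) a₃ b₃
  simp only [Polynomial.eval_one, one_mul] at mass₁ mass₂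
  simp only [Polynomial.eval_mul, Polynomial.eval_C, Polynomial.eval_sub, Polynomial.eval_one,
    Polynomial.eval_X, ← div_eq_inv_mul, one_div] at half_mass₂ half_mass₃
  simp [Polynomial.derivative_pow, -mul_ite, -ite_mul] at parts₁ parts₂ parts₃
  have pos₂ (i) : 1 - η2 i ≠ 0 := (sub_pos.mpr (hr2 i).2).ne'
  have pos₃ (i) : 1 - η3 i ≠ 0 := (sub_pos.mpr (hr3 i).2).ne'
  have expand (a₁ a₂ a₃ b₁ b₂ b₃) : Q (a₁, a₂, a₃) (b₁, b₂, b₃) =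
      (1 - η3 a₃) / 4 * ((1 + η1 a₁) * ω1 a₁ * deriv (lagr η1 b₁) (η1 a₁)) *
          (ω2 a₂ * if a₂ = b₂ then 1 else 0) * (ω3 a₃ * if a₃ = b₃ then 1 else 0)
        + (1 - η3 a₃) / 8 * (ω1 a₁ * if a₁ = b₁ then 1 else 0) *
          ((1 - η2 a₂ ^ 2) * ω2 a₂ * deriv (lagr η2 b₂) (η2 a₂)) *
          (ω3 a₃ * if a₃ = b₃ then 1 else 0)
        + (1 - η2 a₂) / 8 * (ω1 a₁ * if a₁ = b₁ then 1 else 0) *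
          (ω2 a₂ * if a₂ = b₂ then 1 else 0) *
          ((1 - η3 a₃) ^ 2 * ω3 a₃ * deriv (lagr η3 b₃) (η3 a₃)) := by
    rw [hQ]
    have := pos₂ a₂
    have := pos₃ a₃
    field_simp
    ring
  rw [expand, expand]
  dsimp only
  rw [mass₁, mass₂, half_mass₂, half_mass₃]
  have kronecker {n : ℕ} (a b : Fin n) :
      a = b ∧ (if a = b then (1 : ℝ) else 0) = 1 ∧ (if b = a then (1 : ℝ) else 0) = 1 ∨
        (if a = b then (1 : ℝ) else 0) = 0 ∧ (if b = a then (1 : ℝ) else 0) = 0 := by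
    by_cases h : a = b
    · simp [h]
    · simp [h, Ne.symm h]
  have cases₁ := kronecker a₁ b₁
  have cases₂ := kronecker a₂ b₂
  have cases₃ := kronecker a₃ b₃
  clear mass₁ mass₂ half_mass₂ half_mass₃ expand hQ
  generalize (if a₁ = b₁ then (1 : ℝ) else 0) = δ₁, (if b₁ = a₁ then (1 : ℝ) else 0) = ε₁,
    (if a₂ = b₂ then (1 : ℝ) else 0) = δ₂, (if b₂ = a₂ then (1 : ℝ) else 0) = ε₂,
    (if a₃ = b₃ then (1 : ℝ) else 0) = δ₃, (if b₃ = a₃ then (1 : ℝ) else 0) = ε₃ at *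
  rcases cases₁ with ⟨rfl, rfl, rfl⟩ | ⟨rfl, rfl⟩ <;> rcases cases₂ with ⟨rfl, rfl, rfl⟩ | ⟨rfl, rfl⟩ <;>
    rcases cases₃ with ⟨rfl, rfl, rfl⟩ | ⟨rfl, rfl⟩
  · linear_combination (1 - η3 a₃) / 4 * ω2 a₂ * ω3 a₃ * parts₁ +
      (1 - η3 a₃) / 8 * ω1 a₁ * ω3 a₃ * parts₂ +
      (1 - η2 a₂) / 8 * ω1 a₁ * ω2 a₂ * parts₃
  · linear_combination (1 - η2 a₂) / 8 * ω1 a₁ * ω2 a₂ * parts₃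
  · linear_combination (1 - η3 a₃) / 8 * ω1 a₁ * ω3 a₃ * parts₂
  · ring
  · linear_combination (1 - η3 a₃) / 4 * ω2 a₂ * ω3 a₃ * parts₁
  · ring
  · ring
  · ring
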